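/- arXiv:1201.4967 — 9 statements merged into one kernel-verified Lean document; each statement's English description precedes it below -/
import Mathlib

section
/- With q, m, g, x_1, …, x_g as in the integral real-Weil-polynomial setting, one has ∏_{i=1}^g (q + 1 + x_i) ≤ (q + 1 + m)^g, with equality if and only if x_i = m for all i. -/
/-- The tangent-line bound for `log` at `Q`. -/
lemma mul_log_sub_log_le {Q u : ℝ} (hQ : 0 < Q) (hu : 0 < u) :
    Q * (Real.log u - Real.log Q) ≤ u - Q := by
  have h := mul_le_mul_of_nonneg_left (Real.log_le_sub_one_of_pos (div_pos hu hQ)) hQ.le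
  rwa [Real.log_div hu.ne' hQ.ne', mul_sub_one, mul_div_cancel₀ _ hQ.ne'] at h

lemma mul_log_sub_log_add_log_nonpos {Q u y : ℝ} (hQ : 0 < Q) (hu : 0 < u) (hy : 0 < y)
    (h : u + y = Q + 1) : Q * (Real.log u - Real.log Q) + Real.log y ≤ 0 := by
  linarith [mul_log_sub_log_le hQ hu, Real.log_le_sub_one_of_pos hy]

lemma eq_one_of_mul_log_sub_log_add_log_eq_zero {Q u y : ℝ} (hQ : 0 < Q) (hu : 0 < u)
    (hy : 0 < y) (h : u + y = Q + 1)
    (h0 : Q * (Real.log u - Real.log Q) + Real.log y = 0) : y = 1 := by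
  by_contra hne
  linarith [mul_log_sub_log_le hQ hu, Real.log_lt_sub_one_of_pos hy hne]

/-- If `∏ (T + x i)` has integer coefficients and `x i < n` for an integer `n`, then
`∏ (n - x i)` is a positive integer, hence at least `1`. -/
lemma one_le_prod_intCast_sub {ι : Type*} [Fintype ι] (x : ι → ℝ) (p : Polynomial ℤ)
    (hp : p.map (Int.castRingHom ℝ) = ∏ i, (Polynomial.X + Polynomial.C (x i)))
    (n : ℤ) (hn : ∀ i, x i < n) : 1 ≤ ∏ i, ((n : ℝ) - x i) := by
  have heval : ((p.eval (-n) : ℤ) : ℝ) = ∏ i, (-(n : ℝ) + x i) := by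
    have h := congrArg (Polynomial.eval (-(n : ℝ))) hp
    rw [Polynomial.eval_prod] at h
    simp only [Polynomial.eval_add, Polynomial.eval_X, Polynomial.eval_C] at h
    rw [← h, ← Int.cast_neg, Polynomial.eval_intCast_map]
    simp
  have hprod : ∏ i, ((n : ℝ) - x i) = (((-1) ^ Fintype.card ι * p.eval (-n) : ℤ) : ℝ) := by
    push_cast
    rw [heval, ← Finset.card_univ, ← Finset.prod_const, ← Finset.prod_mul_distrib]
    exact Finset.prod_congr rfl fun i _ => by ring
  have hpos : 0 < ∏ i, ((n : ℝ) - x i) := Finset.prod_pos fun i _ => sub_pos.2 (hn i)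
  rw [hprod] at hpos ⊢
  exact_mod_cast hpos


/-- **Serre–Weil upper bound for abelian varieties.**
In the integral real-Weil-polynomial setting (`q ≥ 2` an integer, `m = ⌊2√q⌋`, `g ≥ 1`,
`|x i| ≤ 2√q`, and `∏ (T + x i)` with integer coefficients), one has
`∏ (q + 1 + x i) ≤ (q + 1 + m)^g`, with equality iff `x i = m` for all `i`. -/
theorem stmt_1 (q : ℕ) (hq : 2 ≤ q) (m : ℤ) (hm : m = ⌊2 * Real.sqrt q⌋)
    (g : ℕ) (hg : 1 ≤ g) (x : Fin g → ℝ)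
    (hx : ∀ i, |x i| ≤ 2 * Real.sqrt q)
    (hint : ∃ hz : Polynomial ℤ,
      hz.map (Int.castRingHom ℝ) = ∏ i, (Polynomial.X + Polynomial.C (x i))) :
    (∏ i, ((q : ℝ) + 1 + x i)) ≤ ((q : ℝ) + 1 + m) ^ g ∧
    ((∏ i, ((q : ℝ) + 1 + x i)) = ((q : ℝ) + 1 + m) ^ g ↔ ∀ i, x i = m) := by
  obtain ⟨p, hp⟩ := hint
  have hq' : (2 : ℝ) ≤ q := by exact_mod_cast hq
  have hsq : Real.sqrt q ^ 2 = q := Real.sq_sqrt (by linarith)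
  have hs0 : 0 ≤ Real.sqrt q := Real.sqrt_nonneg _
  have hm0 : (0 : ℝ) ≤ m := by
    have : 0 ≤ m := hm ▸ Int.floor_nonneg.2 (by positivity)
    exact_mod_cast this
  have hmlt : 2 * Real.sqrt q < (m : ℝ) + 1 := hm ▸ Int.lt_floor_add_one _
  have hslt : 2 * Real.sqrt q < (q : ℝ) + 1 := by
    have : 1 < Real.sqrt q := by nlinarith
    nlinarith
  set Q : ℝ := (q : ℝ) + 1 + m with hQdef
  have hQ : 0 < Q := by linarith
  have hu : ∀ i, 0 < (q : ℝ) + 1 + x i := fun i => by linarith [(abs_le.1 (hx i)).1]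
  have hy : ∀ i, 0 < (m : ℝ) + 1 - x i := fun i => by linarith [(abs_le.1 (hx i)).2]
  have huy : ∀ i, ((q : ℝ) + 1 + x i) + ((m : ℝ) + 1 - x i) = Q + 1 := fun i => by
    rw [hQdef]; ring
  have hterm : ∀ i ∈ Finset.univ, Q * (Real.log ((q : ℝ) + 1 + x i) - Real.log Q)
      + Real.log ((m : ℝ) + 1 - x i) ≤ 0 := fun i _ =>
    mul_log_sub_log_add_log_nonpos hQ (hu i) (hy i) (huy i)
  have hnorm : 1 ≤ ∏ i, ((m : ℝ) + 1 - x i) := by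
    simpa using one_le_prod_intCast_sub x p hp (m + 1) fun i => by
      push_cast; linarith [hy i]
  have hP : 0 < ∏ i, ((q : ℝ) + 1 + x i) := Finset.prod_pos fun i _ => hu i
  have hsum : ∑ i, (Q * (Real.log ((q : ℝ) + 1 + x i) - Real.log Q)
      + Real.log ((m : ℝ) + 1 - x i)) =
      Q * (Real.log (∏ i, ((q : ℝ) + 1 + x i)) - Real.log (Q ^ g))
      + Real.log (∏ i, ((m : ℝ) + 1 - x i)) := by
    rw [Real.log_prod fun i _ => (hu i).ne', Real.log_prod fun i _ => (hy i).ne', Real.log_pow,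
      Finset.sum_add_distrib, ← Finset.mul_sum, Finset.sum_sub_distrib]
    simp
  have hlog := Real.log_nonneg hnorm
  have hle := Finset.sum_nonpos hterm
  refine ⟨?_, fun heq i => ?_, fun h => by simp [h, hQdef]⟩
  · rw [← Real.log_le_log_iff hP (pow_pos hQ g)]
    rw [hsum] at hle
    nlinarith
  · have hzero := (Finset.sum_eq_zero_iff_of_nonpos hterm).1
      (le_antisymm hle (by rw [hsum, heq]; simpa using hlog)) i (Finset.mem_univ i)
    linarith [eq_one_of_mul_log_sub_log_add_log_eq_zero hQ (hu i) (hy i) (huy i) hzero]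
end

section
/- With q, m, g, x_1, …, x_g as in the integral real-Weil-polynomial setting, suppose τ = g·m − d with d = 1 or d = 2 (defect d). Then ∏_{i=1}^g (q + 1 + x_i) ≤ (q + m)^d · (q + 1 + m)^{g − d}. -/
open Polynomial in
/-- The nonzero roots of a monic integer polynomial with real roots have a product of absolute
value at least one. -/
theorem sum_log_nonneg_of_prod_X_sub_C_integral {ι : Type*} [Fintype ι] (z : ι → ℝ)
    (p : ℤ[X]) (hp : p.map (Int.castRingHom ℝ) = ∏ i, (X - C (z i))) :
    0 ≤ ∑ i, Real.log (z i) := by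
  classical
  set s : Finset ι := Finset.univ.filter fun i => z i ≠ 0 with hs
  set c : ℕ := (Finset.univ.filter fun i => ¬ z i ≠ 0).card with hc
  have hne : ∀ i ∈ s, z i ≠ 0 := fun i hi => (Finset.mem_filter.mp hi).2
  have hsplit : ∏ i, (X - C (z i)) = X ^ c * ∏ i ∈ s, (X - C (z i)) := by
    rw [← Finset.prod_filter_mul_prod_filter_not Finset.univ (fun i => z i ≠ 0), mul_comm]
    congr 1
    refine Finset.prod_eq_pow_card fun i hi => ?_
    have : z i = 0 := not_not.mp (Finset.mem_filter.mp hi).2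
    simp [this]
  have hcoeff : ((p.coeff c : ℤ) : ℝ) = ∏ i ∈ s, -z i := by
    have h := congrArg (fun r : ℝ[X] => r.coeff (0 + c)) (hp.trans hsplit)
    simp only [coeff_X_pow_mul, coeff_map, coeff_zero_eq_eval_zero, eval_prod] at h
    simpa using h
  have hprod : ∏ i ∈ s, -z i ≠ 0 :=
    Finset.prod_ne_zero_iff.mpr fun i hi => neg_ne_zero.mpr (hne i hi)
  have hone : 1 ≤ |∏ i ∈ s, -z i| := by
    rw [← hcoeff] at hprod ⊢
    exact_mod_cast Int.one_le_abs (Int.cast_ne_zero.mp hprod)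
  calc 0 ≤ Real.log |∏ i ∈ s, -z i| := Real.log_nonneg hone
    _ = ∑ i ∈ s, Real.log (z i) := by
      rw [Real.log_abs, Real.log_prod fun i hi => neg_ne_zero.mpr (hne i hi)]
      simp only [Real.log_neg_eq_log]
    _ = ∑ i, Real.log (z i) := by
      refine Finset.sum_subset (Finset.subset_univ s) fun i _ hi => ?_
      have : z i = 0 := by simpa [hs] using hi
      simp [this]

theorem inv_sub_one_add_log_nonneg {N : ℝ} (hN : 1 < N) :
    0 ≤ 1 / (N - 1) + (Real.log (N - 1) - Real.log N) := by
  have h1 : 0 < N - 1 := by linarith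
  have h := Real.one_sub_inv_le_log_of_pos (div_pos h1 (by linarith : 0 < N))
  rw [Real.log_div h1.ne' (by linarith)] at h
  have : 1 - ((N - 1) / N)⁻¹ = -(1 / (N - 1)) := by
    field_simp
    ring
  linarith

theorem log_sub_le {N z : ℝ} (hN : 1 < N) (hz : -1 ≤ z) (hzN : z < N) :
    Real.log (N - z) ≤ Real.log N + z * (Real.log (N - 1) - Real.log N)
      - (1 / (N - 1) + (Real.log (N - 1) - Real.log N)) * Real.log z := by
  have h0 : 0 < N := by linarith
  have h1 : 0 < N - 1 := by linarith
  have h2 : 0 < N - z := by linarith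
  have ha := inv_sub_one_add_log_nonneg hN
  rcases lt_trichotomy z 0 with hneg | rfl | hpos
  · have hlog : Real.log z ≤ 0 := by
      rw [← Real.log_abs]
      exact Real.log_nonpos (abs_nonneg z) (abs_le.mpr ⟨hz, by linarith⟩)
    have hu := Real.log_le_sub_one_of_pos (div_pos h2 h0)
    rw [Real.log_div h2.ne' h0.ne'] at hu
    have hL := Real.log_le_sub_one_of_pos (div_pos h1 h0)
    rw [Real.log_div h1.ne' h0.ne'] at hL
    have e1 : (N - z) / N - 1 = z * ((N - 1) / N - 1) := by
      field_simp
      ring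
    have := mul_le_mul_of_nonpos_left hL hneg.le
    have := mul_nonpos_of_nonneg_of_nonpos ha hlog
    linarith
  · simp
  · have hlog := mul_le_mul_of_nonneg_left (Real.log_le_sub_one_of_pos hpos) ha
    have hu := Real.log_le_sub_one_of_pos (div_pos h2 h1)
    rw [Real.log_div h2.ne' h1.ne'] at hu
    have e1 : (N - z) / (N - 1) - 1 = -(1 / (N - 1) * (z - 1)) := by
      field_simp
      ring
    linarith


/-- **Defect `d` upper bound (`d = 1` or `d = 2`).**
In the integral real-Weil-polynomial setting, if `τ = g·m − d` with `d ∈ {1, 2}`, then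
`∏ (q + 1 + x i) ≤ (q + m)^d · (q + 1 + m)^(g − d)` (the last power being an integer
power of the positive real `q + 1 + m`). -/
theorem stmt_2 (q : ℕ) (hq : 2 ≤ q) (m : ℤ) (hm : m = ⌊2 * Real.sqrt q⌋)
    (g : ℕ) (hg : 1 ≤ g) (x : Fin g → ℝ)
    (hx : ∀ i, |x i| ≤ 2 * Real.sqrt q)
    (hint : ∃ hz : Polynomial ℤ,
      hz.map (Int.castRingHom ℝ) = ∏ i, (Polynomial.X + Polynomial.C (x i)))
    (τ : ℤ) (hτ : (τ : ℝ) = ∑ i, x i)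
    (d : ℕ) (hd : d = 1 ∨ d = 2) (hdef : τ = g * m - d) :
    (∏ i, ((q : ℝ) + 1 + x i)) ≤ ((q : ℝ) + m) ^ d * ((q : ℝ) + 1 + m) ^ ((g : ℤ) - d) := by
  obtain ⟨p, hp⟩ := hint
  have hq2 : (2 : ℝ) ≤ q := by exact_mod_cast hq
  have hsq : Real.sqrt q ^ 2 = q := Real.sq_sqrt (by linarith)
  have hsq1 : 1 < Real.sqrt q := Real.lt_sqrt_of_sq_lt (by linarith)
  have hmlt : 2 * Real.sqrt q < m + 1 := hm ▸ Int.lt_floor_add_one _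
  have hN : (1 : ℝ) < q + 1 + m := by linarith
  have hpos : ∀ i, 0 < (q : ℝ) + 1 + x i := fun i => by
    nlinarith [(abs_le.mp (hx i)).1, sq_pos_of_pos (sub_pos.mpr hsq1)]
  have hlogs : 0 ≤ ∑ i, Real.log (m - x i) := by
    refine sum_log_nonneg_of_prod_X_sub_C_integral _
      (p.comp (Polynomial.X - Polynomial.C m)) ?_
    rw [Polynomial.map_comp, hp, Polynomial.prod_comp]
    refine Finset.prod_congr rfl fun i _ => ?_
    simp only [Polynomial.add_comp, Polynomial.X_comp, Polynomial.C_comp, Polynomial.map_sub,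
      Polynomial.map_X, Polynomial.map_C, Polynomial.C_sub, Int.coe_castRingHom]
    ring
  have hsum : ∑ i, ((m : ℝ) - x i) = d := by
    have : (τ : ℝ) = g * m - d := by exact_mod_cast hdef
    rw [Finset.sum_sub_distrib, ← hτ, this]
    simp
  have hN0 : (0 : ℝ) < q + 1 + m := by linarith
  have hN1 : (0 : ℝ) < q + m := by linarith
  rw [← Real.log_le_log_iff (Finset.prod_pos fun i _ => hpos i) (by positivity),
    Real.log_prod fun i _ => (hpos i).ne',
    Real.log_mul (by positivity) (by positivity), Real.log_pow, Real.log_zpow]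
  have hterm : ∀ i, Real.log ((q : ℝ) + 1 + x i) ≤ Real.log (q + 1 + m)
      + (m - x i) * (Real.log (q + 1 + m - 1) - Real.log (q + 1 + m))
      - (1 / ((q : ℝ) + 1 + m - 1) + (Real.log (q + 1 + m - 1) - Real.log (q + 1 + m)))
        * Real.log (m - x i) := fun i => by
    have h := log_sub_le (z := m - x i) hN (by linarith [(abs_le.mp (hx i)).2])
      (by linarith [hpos i])
    rwa [show (q : ℝ) + 1 + m - (m - x i) = q + 1 + x i by ring] at h
  refine (Finset.sum_le_sum fun i _ => hterm i).trans ?_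
  rw [Finset.sum_sub_distrib, Finset.sum_add_distrib, ← Finset.sum_mul, ← Finset.mul_sum, hsum]
  have := mul_nonneg (inv_sub_one_add_log_nonneg hN) hlogs
  rw [show (q : ℝ) + 1 + m - 1 = q + m by ring] at this ⊢
  simp only [Finset.sum_const, Finset.card_univ, Fintype.card_fin, nsmul_eq_mul]
  push_cast
  linarith
end

section
/- With q, m, g, x_1, …, x_g as in the integral real-Weil-polynomial setting, assume g ≥ 2 and let r = τ − g·⌊τ/g⌋ be the remainder of the Euclidean division of τ by g. If r = 1 or r = g − 1, then ∏_{i=1}^g (q + 1 + x_i) ≤ (q + 1 + ⌊τ/g⌋)^{g − r} · (q + 2 + ⌊τ/g⌋)^{r}. -/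
open Polynomial in
/-- Removing from a finite family of reals all members equal to a given integer preserves
integrality of the monic polynomial `∏ (X + x i)`. -/
theorem exists_int_poly_filter_ne {ι : Type*} [DecidableEq ι] (x : ι → ℝ) (d : ℤ)
    (s : Finset ι)
    (h : ∃ p : ℤ[X], p.map (Int.castRingHom ℝ) = ∏ i ∈ s, (X + C (x i))) :
    ∃ p : ℤ[X], p.map (Int.castRingHom ℝ) = ∏ i ∈ s with x i ≠ d, (X + C (x i)) := by
  induction s using Finset.strongInduction with
  | H s ih =>
    by_cases hd : ∃ i ∈ s, x i = d
    · obtain ⟨i, hi, hxi⟩ := hd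
      obtain ⟨p, hp⟩ := h
      rw [← Finset.mul_prod_erase s _ hi, hxi] at hp
      have hroot : p.IsRoot (-d) := by
        have hev := congrArg (Polynomial.eval (((-d : ℤ) : ℝ))) hp
        rw [Polynomial.eval_intCast_map] at hev
        simpa using hev
      obtain ⟨p', rfl⟩ := Polynomial.dvd_iff_isRoot.mpr hroot
      have hfilter : s.filter (fun j => x j ≠ d) = (s.erase i).filter (fun j => x j ≠ d) := by
        ext j
        simp only [Finset.mem_filter, Finset.mem_erase]
        constructor
        · rintro ⟨hj, hne⟩
          exact ⟨⟨fun hji => hne (hji ▸ hxi), hj⟩, hne⟩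
        · rintro ⟨⟨-, hj⟩, hne⟩
          exact ⟨hj, hne⟩
      rw [hfilter]
      refine ih _ (Finset.erase_ssubset hi) ⟨p', ?_⟩
      refine mul_left_cancel₀ (Polynomial.X_add_C_ne_zero (d : ℝ)) ?_
      rw [← hp]
      simp
    · push Not at hd
      rwa [Finset.filter_true_of_mem hd]

open Polynomial in
theorem one_le_abs_prod_sub_intCast {ι : Type*} (x : ι → ℝ) (d : ℤ) (s : Finset ι)
    (h : ∃ p : ℤ[X], p.map (Int.castRingHom ℝ) = ∏ i ∈ s, (X + C (x i)))
    (hd : ∀ i ∈ s, x i ≠ d) : 1 ≤ |∏ i ∈ s, (x i - d)| := by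
  obtain ⟨p, hp⟩ := h
  have hev := congrArg (Polynomial.eval (((-d : ℤ) : ℝ))) hp
  rw [Polynomial.eval_intCast_map, Polynomial.eval_prod] at hev
  have heq : ((p.eval (-d) : ℤ) : ℝ) = ∏ i ∈ s, (x i - d) := by
    simpa [sub_eq_neg_add] using hev
  have hne : p.eval (-d) ≠ 0 := by
    intro h0
    rw [h0, Int.cast_zero] at heq
    exact Finset.prod_ne_zero_iff.mpr (fun i hi => sub_ne_zero.mpr (hd i hi)) heq.symm
  rw [← heq]
  exact_mod_cast Int.one_le_abs hne

theorem log_one_sub_le {u : ℝ} (h0 : 0 ≤ u) (h1 : u < 1) :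
    Real.log (1 - u) ≤ -u - u ^ 2 / 2 := by
  have h := Real.hasSum_pow_div_log_of_abs_lt_one (x := u) (by rwa [abs_of_nonneg h0])
  have h2 := sum_le_hasSum (Finset.range 2) (fun n _ => by positivity) h
  simp only [Finset.sum_range_succ, Finset.sum_range_zero] at h2
  norm_num at h2
  linarith

theorem log_one_add_le {u : ℝ} (h0 : 0 ≤ u) :
    Real.log (1 + u) ≤ u - u ^ 2 / (2 * (1 + u)) := by
  have h := Real.self_le_sinh_iff.mpr (Real.log_nonneg (by linarith : (1 : ℝ) ≤ 1 + u))
  rw [Real.sinh_log (by linarith)] at h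
  refine h.trans_eq ?_
  field_simp
  ring

theorem neg_add_sq_le_log_one_sub {v : ℝ} (h0 : 0 ≤ v) (h1 : v ≤ 1 / 2) :
    -(v + v ^ 2) ≤ Real.log (1 - v) := by
  rw [Real.le_log_iff_exp_le (by linarith), Real.exp_neg,
    inv_le_iff_one_le_mul₀ (Real.exp_pos _)]
  have h := Real.quadratic_le_exp_of_nonneg (by positivity : 0 ≤ v + v ^ 2)
  calc (1 : ℝ) ≤ (1 - v) * (1 + (v + v ^ 2) + (v + v ^ 2) ^ 2 / 2) := by
        have h2 : 0 ≤ 1 - v - v ^ 2 - v ^ 3 := by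
          nlinarith [mul_nonneg (mul_nonneg h0 h0) (sub_nonneg.mpr h1),
            mul_nonneg h0 (sub_nonneg.mpr h1)]
        nlinarith [mul_nonneg (mul_nonneg h0 h0) h2]
    _ ≤ _ := mul_le_mul_of_nonneg_left h (by linarith)

/-- The chord of `log` through `a` and `a + 1`, minus `log`, dominates a positive multiple of
`log |(y - a) (y - (a + 1))|`. -/
theorem log_abs_mul_le_chord_sub_log {a y : ℝ} (ha : 1 ≤ a) (hy : 0 < y) (hya : y ≠ a)
    (hyb : y ≠ a + 1) :
    1 / (2 * (a + 1) ^ 2) * (Real.log |y - a| + Real.log |y - (a + 1)|) ≤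
      Real.log a + (y - a) * (Real.log (a + 1) - Real.log a) - Real.log y := by
  have ha0 : 0 < a := by linarith
  have hb0 : 0 < a + 1 := by linarith
  have hlam : Real.log (1 - 1 / (a + 1)) = Real.log a - Real.log (a + 1) := by
    rw [← Real.log_div ha0.ne' hb0.ne']
    congr 1
    field_simp
    ring
  rcases lt_or_gt_of_ne hya with h | h
  · obtain ⟨s, rfl⟩ : ∃ s, y = a - s := ⟨a - y, by ring⟩
    have hs : 0 < s := by linarith
    have e1 : |a - s - a| = s := by rw [sub_sub_cancel_left, abs_neg, abs_of_pos hs]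
    have e2 : |a - s - (a + 1)| = s + 1 := by
      rw [show a - s - (a + 1) = -(s + 1) by ring, abs_neg, abs_of_pos (by linarith)]
    rw [e1, e2]
    have l1 := Real.log_le_sub_one_of_pos hs
    have l2 := Real.log_le_sub_one_of_pos (by linarith : 0 < s + 1)
    have l3 := log_one_sub_le (u := s / a) (by positivity) ((div_lt_one ha0).mpr (by linarith))
    have l4 : Real.log (1 - s / a) = Real.log (a - s) - Real.log a := by
      rw [← Real.log_div hy.ne' ha0.ne']
      congr 1
      field_simp
    have l5 : Real.log (a + 1) - Real.log a ≤ 1 / a := by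
      have := Real.log_le_sub_one_of_pos (by positivity : 0 < (a + 1) / a)
      rw [Real.log_div hb0.ne' ha0.ne'] at this
      refine this.trans_eq ?_
      field_simp
      ring
    have l6 : s * (Real.log (a + 1) - Real.log a) ≤ s / a := by
      calc _ ≤ s * (1 / a) := by gcongr
        _ = _ := by ring
    calc 1 / (2 * (a + 1) ^ 2) * (Real.log s + Real.log (s + 1))
        ≤ 1 / (2 * (a + 1) ^ 2) * s ^ 2 := by
          gcongr
          nlinarith [sq_nonneg (s - 1)]
      _ ≤ 1 / (2 * a ^ 2) * s ^ 2 := by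
          gcongr
          linarith
      _ = (s / a) ^ 2 / 2 := by
          field_simp
      _ ≤ _ := by
          linarith
  rcases lt_or_gt_of_ne hyb with h' | h'
  · obtain ⟨t, rfl⟩ : ∃ t, y = a + 1 - t := ⟨a + 1 - y, by ring⟩
    have ht : 0 < t := by linarith
    have ht1 : 0 < 1 - t := by linarith
    have e1 : |a + 1 - t - a| = 1 - t := by
      rw [show a + 1 - t - a = 1 - t by ring, abs_of_pos ht1]
    have e2 : |a + 1 - t - (a + 1)| = t := by rw [sub_sub_cancel_left, abs_neg, abs_of_pos ht]
    rw [e1, e2]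
    have l1 := Real.log_le_sub_one_of_pos ht
    have l2 := Real.log_le_sub_one_of_pos ht1
    have l3 := log_one_sub_le (u := t / (a + 1)) (by positivity)
      ((div_lt_one hb0).mpr (by linarith))
    have l4 : Real.log (1 - t / (a + 1)) = Real.log (a + 1 - t) - Real.log (a + 1) := by
      rw [← Real.log_div hy.ne' hb0.ne']
      congr 1
      field_simp
    have l5 := neg_add_sq_le_log_one_sub (v := 1 / (a + 1)) (by positivity)
      (by gcongr; linarith)
    rw [hlam] at l5
    have l6 : t * (Real.log (a + 1) - Real.log a) ≤ t * (1 / (a + 1) + (1 / (a + 1)) ^ 2) := by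
      gcongr
      linarith
    calc 1 / (2 * (a + 1) ^ 2) * (Real.log (1 - t) + Real.log t)
        ≤ 1 / (2 * (a + 1) ^ 2) * (t ^ 2 - 2 * t) := by
          gcongr
          nlinarith [sq_nonneg (t - 1)]
      _ = t / (a + 1) + (t / (a + 1)) ^ 2 / 2 - t * (1 / (a + 1) + (1 / (a + 1)) ^ 2) := by
          field_simp
          ring
      _ ≤ _ := by
          linarith
  · obtain ⟨s, rfl⟩ : ∃ s, y = a + 1 + s := ⟨y - (a + 1), by ring⟩
    have hs : 0 < s := by linarith
    have e1 : |a + 1 + s - a| = s + 1 := by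
      rw [show a + 1 + s - a = s + 1 by ring, abs_of_pos (by linarith)]
    have e2 : |a + 1 + s - (a + 1)| = s := by rw [add_sub_cancel_left, abs_of_pos hs]
    rw [e1, e2]
    have l1 := Real.log_le_sub_one_of_pos hs
    have l2 := Real.log_le_sub_one_of_pos (by linarith : 0 < s + 1)
    have l3 := log_one_add_le (u := s / (a + 1)) (by positivity)
    have l4 : Real.log (1 + s / (a + 1)) = Real.log (a + 1 + s) - Real.log (a + 1) := by
      rw [← Real.log_div hy.ne' hb0.ne']
      congr 1
      field_simp
    have l5 := log_one_sub_le (u := 1 / (a + 1)) (by positivity)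
      ((div_lt_one hb0).mpr (by linarith))
    rw [hlam] at l5
    have l6 : s * (1 / (a + 1) + (1 / (a + 1)) ^ 2 / 2) ≤ s * (Real.log (a + 1) - Real.log a) := by
      gcongr
      linarith
    have key : 2 * s - 1 ≤ (a + 1) * s ^ 2 / (a + 1 + s) + s := by
      rw [← sub_le_iff_le_add, le_div_iff₀ hy]
      nlinarith [mul_nonneg ha0.le (sq_nonneg (s - 1)), sq_nonneg (s - 1)]
    calc 1 / (2 * (a + 1) ^ 2) * (Real.log (s + 1) + Real.log s)
        ≤ 1 / (2 * (a + 1) ^ 2) * ((a + 1) * s ^ 2 / (a + 1 + s) + s) :=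
          mul_le_mul_of_nonneg_left (by linarith) (by positivity)
      _ = s * (1 / (a + 1) + (1 / (a + 1)) ^ 2 / 2)
            - (s / (a + 1) - (s / (a + 1)) ^ 2 / (2 * (1 + s / (a + 1)))) := by
          field_simp
          ring
      _ ≤ _ := by
          linarith


/-- **Upper bound depending on the remainder `r` of `τ` modulo `g`.**
In the integral real-Weil-polynomial setting with `g ≥ 2`, let `r = τ − g⌊τ/g⌋` be the
remainder of the Euclidean division of `τ` by `g`. If `r = 1` or `r = g − 1`, then
`∏ (q + 1 + x i) ≤ (q + 1 + ⌊τ/g⌋)^(g−r) · (q + 2 + ⌊τ/g⌋)^r`.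
(Here `τ / g` and `τ % g` denote integer floor division and remainder, valid since `g > 0`.) -/
theorem stmt_3 (q : ℕ) (hq : 2 ≤ q) (m : ℤ) (hm : m = ⌊2 * Real.sqrt q⌋)
    (g : ℕ) (hg : 2 ≤ g) (x : Fin g → ℝ)
    (hx : ∀ i, |x i| ≤ 2 * Real.sqrt q)
    (hint : ∃ hz : Polynomial ℤ,
      hz.map (Int.castRingHom ℝ) = ∏ i, (Polynomial.X + Polynomial.C (x i)))
    (τ : ℤ) (hτ : (τ : ℝ) = ∑ i, x i)
    (r : ℤ) (hr : r = τ % (g : ℤ)) (hcase : r = 1 ∨ r = (g : ℤ) - 1) :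
    (∏ i, ((q : ℝ) + 1 + x i)) ≤
      ((q : ℝ) + 1 + ((τ / (g : ℤ) : ℤ) : ℝ)) ^ ((g : ℤ) - r).toNat *
        ((q : ℝ) + 2 + ((τ / (g : ℤ) : ℤ) : ℝ)) ^ r.toNat := by
  have hg0 : (0 : ℤ) < g := by exact_mod_cast (by omega : 0 < g)
  have hr0 : 0 ≤ r := hr ▸ Int.emod_nonneg _ hg0.ne'
  have hrg : r < g := hr ▸ Int.emod_lt_of_pos _ hg0
  set k : ℤ := τ / (g : ℤ) with hk
  have hdiv : τ = g * k + r := by rw [hr, hk, Int.mul_ediv_add_emod]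
  have hpos : ∀ i, 0 < (q : ℝ) + 1 + x i := by
    intro i
    have h1 := (abs_le.mp (hx i)).1
    have h2 : Real.sqrt q ^ 2 = q := Real.sq_sqrt (Nat.cast_nonneg q)
    have h3 : 1 < Real.sqrt q := Real.lt_sqrt_of_sq_lt (by exact_mod_cast (by omega : 1 ^ 2 < q))
    nlinarith [pow_pos (sub_pos.mpr h3) 2]
  have hsum : ∑ i, ((q : ℝ) + 1 + x i) = g * (q + 1 + k) + r := by
    rw [Finset.sum_add_distrib, ← hτ, hdiv]
    simp
    ring
  have ha : (1 : ℝ) ≤ q + 1 + k := by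
    have h1 : 1 ≤ |∏ i, (x i - ((-(q + 1) : ℤ) : ℝ))| := by
      refine one_le_abs_prod_sub_intCast x _ _ hint fun i _ h => ?_
      have := hpos i
      push_cast at h
      linarith
    have h2 : ∏ i, (x i - ((-(q + 1) : ℤ) : ℝ)) = ∏ i, ((q : ℝ) + 1 + x i) :=
      Finset.prod_congr rfl fun i _ => by push_cast; ring
    rw [h2, abs_of_pos (Finset.prod_pos fun i _ => hpos i)] at h1
    have h3 := Real.log_nonneg h1
    rw [Real.log_prod fun i _ => (hpos i).ne'] at h3
    have h4 : ∑ i, Real.log ((q : ℝ) + 1 + x i) ≤ ∑ i, ((q : ℝ) + 1 + x i - 1) :=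
      Finset.sum_le_sum fun i _ => Real.log_le_sub_one_of_pos (hpos i)
    rw [Finset.sum_sub_distrib, hsum] at h4
    have h5 : (g : ℝ) ≤ g * (q + 1 + k) + r := by
      simp at h4
      linarith
    have h6 : (g : ℤ) ≤ g * (q + 1 + k) + r := by exact_mod_cast h5
    have h7 : 0 < (q : ℤ) + 1 + k := by
      by_contra! hcon
      nlinarith
    exact_mod_cast h7
  set a : ℝ := q + 1 + k with hadef
  have hb : (q : ℝ) + 2 + k = a + 1 := by rw [hadef]; ring
  rw [hb]
  have ha0 : 0 < a := by linarith
  classical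
  set s := (Finset.univ.filter fun i => x i ≠ k).filter fun i => x i ≠ ((k + 1 : ℤ) : ℝ) with hs
  have hints := exists_int_poly_filter_ne x (k + 1) _ (exists_int_poly_filter_ne x k _ hint)
  rw [← hs] at hints
  have hmem : ∀ i, i ∈ s ↔ x i ≠ k ∧ x i ≠ k + 1 := by
    intro i
    simp [hs]
  have hlog : ∀ d : ℤ, (∀ i ∈ s, x i ≠ d) → 0 ≤ ∑ i ∈ s, Real.log |x i - d| := by
    intro d hd
    rw [← Real.log_prod fun i hi => abs_ne_zero.mpr (sub_ne_zero.mpr (hd i hi)),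
      ← Finset.abs_prod]
    exact Real.log_nonneg (one_le_abs_prod_sub_intCast x d s hints hd)
  have hlog0 := hlog k fun i hi => ((hmem i).mp hi).1
  have hlog1 := hlog (k + 1) fun i hi => by
    push_cast
    exact ((hmem i).mp hi).2
  set f : ℝ → ℝ := fun y =>
    Real.log a + (y - a) * (Real.log (a + 1) - Real.log a) - Real.log y with hf
  have hfs : 0 ≤ ∑ i ∈ s, f (q + 1 + x i) := by
    calc (0 : ℝ) ≤ 1 / (2 * (a + 1) ^ 2) *
          (∑ i ∈ s, Real.log |x i - k| + ∑ i ∈ s, Real.log |x i - ((k + 1 : ℤ) : ℝ)|) := by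
          positivity
      _ = ∑ i ∈ s, 1 / (2 * (a + 1) ^ 2) *
          (Real.log |q + 1 + x i - a| + Real.log |q + 1 + x i - (a + 1)|) := by
          rw [← Finset.sum_add_distrib, Finset.mul_sum]
          refine Finset.sum_congr rfl fun i _ => ?_
          rw [show (q : ℝ) + 1 + x i - a = x i - k by rw [hadef]; ring,
            show (q : ℝ) + 1 + x i - (a + 1) = x i - ((k + 1 : ℤ) : ℝ) by
              rw [hadef]; push_cast; ring]
      _ ≤ _ := by
          refine Finset.sum_le_sum fun i hi => ?_
          obtain ⟨h1, h2⟩ := (hmem i).mp hi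
          refine log_abs_mul_le_chord_sub_log ha (hpos i) (fun h => h1 ?_) (fun h => h2 ?_)
          · rw [hadef] at h
            linarith
          · rw [hadef] at h
            linarith
  have hfuniv : ∑ i ∈ s, f (q + 1 + x i) = ∑ i, f (q + 1 + x i) := by
    refine Finset.sum_subset (Finset.subset_univ s) fun i _ hi => ?_
    rw [hmem, not_and_or, not_not, not_not] at hi
    rcases hi with h | h
    · rw [h, ← hadef]
      simp [hf]
    · rw [show (q : ℝ) + 1 + x i = a + 1 by rw [h, hadef]; ring]
      simp [hf]
  have hftotal : ∑ i, f (q + 1 + x i) = g * Real.log a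
      + r * (Real.log (a + 1) - Real.log a) - ∑ i, Real.log (q + 1 + x i) := by
    simp only [hf]
    rw [Finset.sum_sub_distrib, Finset.sum_add_distrib, ← Finset.sum_mul,
      Finset.sum_sub_distrib, hsum]
    simp
  have hN : ((((g : ℤ) - r).toNat : ℕ) : ℝ) = g - r := by
    exact_mod_cast congrArg (Int.cast (R := ℝ)) (Int.toNat_of_nonneg (by omega : 0 ≤ (g : ℤ) - r))
  have hR : ((r.toNat : ℕ) : ℝ) = r := by
    exact_mod_cast congrArg (Int.cast (R := ℝ)) (Int.toNat_of_nonneg hr0)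
  rw [← Real.log_le_log_iff (Finset.prod_pos fun i _ => hpos i) (by positivity),
    Real.log_prod fun i _ => (hpos i).ne', Real.log_mul (by positivity) (by positivity),
    Real.log_pow, Real.log_pow, hN, hR]
  rw [hfuniv, hftotal] at hfs
  linarith
end

section
/- Let q ≥ 2 be a real number, g ≥ 1 an integer, and x_1, …, x_g real numbers with |x_i| ≤ 2√q; set τ = x_1 + ⋯ + x_g. Let M(q) = 1/S(h(q)), where S is Specht's ratio and h(q) = ((√q + 1)/(√q − 1))². Then ∏_{i=1}^g (q + 1 + x_i) ≥ M(q)^g · (q + 1 + τ/g)^g. -/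
/-- Specht's ratio: `S(h) = h^(1/(h−1)) / (e · log(h^(1/(h−1))))` for `h > 1`, `S(1) = 1`. -/
noncomputable def spechtRatio (h : ℝ) : ℝ :=
  if h = 1 then 1
  else h ^ ((1 : ℝ) / (h - 1)) / (Real.exp 1 * Real.log (h ^ ((1 : ℝ) / (h - 1))))

theorem spechtRatio_eq_exp {h : ℝ} (hh : 1 < h) :
    spechtRatio h =
      Real.exp (Real.log h / (h - 1)) / (Real.exp 1 * (Real.log h / (h - 1))) := by
  have hrpow : h ^ ((1 : ℝ) / (h - 1)) = Real.exp (Real.log h / (h - 1)) := by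
    rw [Real.rpow_def_of_pos (by linarith), mul_one_div]
  rw [spechtRatio, if_neg hh.ne', hrpow, Real.log_exp]

theorem spechtRatio_pos {h : ℝ} (hh : 1 < h) : 0 < spechtRatio h := by
  have hL : 0 < Real.log h / (h - 1) := div_pos (Real.log_pos hh) (by linarith)
  rw [spechtRatio_eq_exp hh]
  positivity

theorem le_spechtRatio_mul_exp {h : ℝ} (hh : 1 < h) (t : ℝ) :
    t ≤ spechtRatio h * Real.exp ((t - 1) * (Real.log h / (h - 1))) := by
  have hL : 0 < Real.log h / (h - 1) := div_pos (Real.log_pos hh) (by linarith)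
  rw [spechtRatio_eq_exp hh]
  set L := Real.log h / (h - 1)
  have hexp : Real.exp L / (Real.exp 1 * L) * Real.exp ((t - 1) * L) =
      Real.exp (t * L - 1) / L := by
    rw [div_mul_eq_mul_div, ← Real.exp_add, show L + (t - 1) * L = t * L - 1 + 1 by ring,
      Real.exp_add, mul_comm (Real.exp 1) L, mul_div_mul_right _ _ (Real.exp_ne_zero 1)]
  rw [hexp, le_div_iff₀ hL]
  linarith [Real.add_one_le_exp (t * L - 1)]

/-- On `[1, h]` the chord of the logarithm lies below its graph, in exponential form. -/
theorem exp_chord_log_le {h t : ℝ} (hh : 1 < h) (h1t : 1 ≤ t) (hth : t ≤ h) :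
    Real.exp ((t - 1) * (Real.log h / (h - 1))) ≤ t := by
  have hpos : 0 < h - 1 := by linarith
  have bernoulli := rpow_one_add_le_one_add_mul_self (s := h - 1) (by linarith)
    (p := (t - 1) / (h - 1)) (div_nonneg (by linarith) hpos.le)
    ((div_le_one hpos).2 (by linarith))
  rw [add_sub_cancel, div_mul_cancel₀ _ hpos.ne', add_sub_cancel,
    Real.rpow_def_of_pos (by linarith)] at bernoulli
  convert bernoulli using 2
  ring

/-- **Specht's inequality**: the arithmetic mean of reals in `[a, h * a]` is at most
`spechtRatio h` times their geometric mean. -/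
theorem specht_inequality {ι : Type*} [Fintype ι] [Nonempty ι] {a h : ℝ} (ha : 0 < a)
    (hh : 1 < h) (c : ι → ℝ) (hac : ∀ i, a ≤ c i) (hcb : ∀ i, c i ≤ h * a) :
    ((∑ i, c i) / Fintype.card ι) ^ Fintype.card ι ≤
      spechtRatio h ^ Fintype.card ι * ∏ i, c i := by
  set m := (∑ i, c i) / (Fintype.card ι : ℝ) with hm
  set L := Real.log h / (h - 1)
  have hcard : (Fintype.card ι : ℝ) ≠ 0 := Nat.cast_ne_zero.2 Fintype.card_ne_zero
  have hm0 : 0 ≤ m :=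
    div_nonneg (Finset.sum_nonneg fun i _ => ha.le.trans (hac i)) (Nat.cast_nonneg _)
  have hmean : m ≤ spechtRatio h * (a * Real.exp ((m / a - 1) * L)) := by
    have := mul_le_mul_of_nonneg_left (le_spechtRatio_mul_exp hh (m / a)) ha.le
    rw [mul_div_cancel₀ _ ha.ne'] at this
    linarith
  have hsum : ∑ i, (c i / a - 1) * L = Fintype.card ι * ((m / a - 1) * L) := by
    rw [← Finset.sum_mul, Finset.sum_sub_distrib, ← Finset.sum_div, hm]
    simp only [Finset.sum_const, Finset.card_univ, nsmul_eq_mul]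
    field_simp
  have hprod : (a * Real.exp ((m / a - 1) * L)) ^ Fintype.card ι ≤ ∏ i, c i := by
    calc (a * Real.exp ((m / a - 1) * L)) ^ Fintype.card ι
        = ∏ i, a * Real.exp ((c i / a - 1) * L) := by
          rw [Finset.prod_mul_distrib, ← Real.exp_sum, hsum, Real.exp_nat_mul, mul_pow,
            Finset.prod_const, Finset.card_univ]
      _ ≤ ∏ i, c i := by
          refine Finset.prod_le_prod (fun i _ => by positivity) fun i _ => ?_
          have := exp_chord_log_le hh ((one_le_div ha).2 (hac i)) ((div_le_iff₀ ha).2 (hcb i))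
          rwa [le_div_iff₀' ha] at this
  calc m ^ Fintype.card ι
      ≤ (spechtRatio h * (a * Real.exp ((m / a - 1) * L))) ^ Fintype.card ι :=
        pow_le_pow_left₀ hm0 hmean _
    _ ≤ spechtRatio h ^ Fintype.card ι * ∏ i, c i := by
        rw [mul_pow]
        exact mul_le_mul_of_nonneg_left hprod (pow_pos (spechtRatio_pos hh) _).le

/-- **Specht-type lower bound.**
Let `q ≥ 2` be real, `g ≥ 1`, `|x i| ≤ 2√q`, `τ = Σ x i`. With `M(q) = 1/S(h(q))`,
where `S` is Specht's ratio and `h(q) = ((√q + 1)/(√q − 1))²`, one has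
`∏ (q + 1 + x i) ≥ M(q)^g · (q + 1 + τ/g)^g`. -/
theorem stmt_4 (q : ℝ) (hq : 2 ≤ q) (g : ℕ) (hg : 1 ≤ g) (x : Fin g → ℝ)
    (hx : ∀ i, |x i| ≤ 2 * Real.sqrt q) (τ : ℝ) (hτ : τ = ∑ i, x i) :
    (1 / spechtRatio (((Real.sqrt q + 1) / (Real.sqrt q - 1)) ^ 2)) ^ g *
        (q + 1 + τ / g) ^ g ≤ ∏ i, (q + 1 + x i) := by
  have : NeZero g := ⟨by omega⟩
  have hg0 : (g : ℝ) ≠ 0 := Nat.cast_ne_zero.2 (by omega)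
  have hsq : Real.sqrt q ^ 2 = q := Real.sq_sqrt (by linarith)
  have hs1 : 0 < Real.sqrt q - 1 := sub_pos.2 (Real.lt_sqrt_of_sq_lt (by linarith))
  set h := ((Real.sqrt q + 1) / (Real.sqrt q - 1)) ^ 2 with hdef
  have hh : 1 < h := one_lt_pow₀ ((one_lt_div hs1).2 (by linarith)) two_ne_zero
  have hha : h * (Real.sqrt q - 1) ^ 2 = (Real.sqrt q + 1) ^ 2 := by
    rw [hdef, div_pow, div_mul_cancel₀ _ (pow_pos hs1 2).ne']
  have specht := specht_inequality (pow_pos hs1 2) hh (fun i => q + 1 + x i)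
    (fun i => by nlinarith [(abs_le.1 (hx i)).1])
    (fun i => by rw [hha]; nlinarith [(abs_le.1 (hx i)).2])
  have hmean : (∑ i, (q + 1 + x i)) / (g : ℝ) = q + 1 + τ / g := by
    rw [Finset.sum_add_distrib, ← hτ]
    simp only [Finset.sum_const, Finset.card_univ, Fintype.card_fin, nsmul_eq_mul]
    field_simp
  rw [Fintype.card_fin, hmean] at specht
  rwa [one_div, inv_pow, inv_mul_le_iff₀ (pow_pos (spechtRatio_pos hh) g)]
end

section
/- With q, m, g, x_1, …, x_g as in the integral real-Weil-polynomial setting, one has ∏_{i=1}^g (q + 1 + x_i) ≥ (q + 1 − m)^g + (q − m)^{g−1}·(g·m + τ), with the convention 0^0 = 1 (relevant when g = 1 and q = m). -/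
open Real in
/-- Weighted form of `exp u ≥ 1 + u`, summed over the expansion of `∏ (a + exp (t i))`. -/
theorem add_mul_sum_le_exp_mul_prod {ι : Type*} {a : ℝ} (ha : 0 ≤ a) (t : ι → ℝ)
    (s : Finset ι) (c : ℝ) :
    (1 + c) * (a + 1) ^ s.card + (a + 1) ^ s.card / (a + 1) * ∑ i ∈ s, t i ≤
      exp c * ∏ i ∈ s, (a + exp (t i)) := by
  induction s using Finset.cons_induction generalizing c with
  | empty => simpa [add_comm] using add_one_le_exp c
  | cons j s hj ih =>
    have h₁ := mul_le_mul_of_nonneg_left (ih c) ha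
    have h₂ := ih (c + t j)
    rw [exp_add] at h₂
    rw [Finset.card_cons, Finset.sum_cons, Finset.prod_cons]
    have ha' : a + 1 ≠ 0 := by positivity
    calc _ = a * ((1 + c) * (a + 1) ^ s.card + (a + 1) ^ s.card / (a + 1) * ∑ i ∈ s, t i) +
          ((1 + (c + t j)) * (a + 1) ^ s.card +
            (a + 1) ^ s.card / (a + 1) * ∑ i ∈ s, t i) := by
          field_simp
          ring
      _ ≤ _ := add_le_add h₁ h₂
      _ = _ := by ring

open Real in
/-- The variant of `add_mul_sum_le_exp_mul_prod` with the constant term removed on both sides. -/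
theorem add_mul_sum_le_exp_mul_prod_sub {ι : Type*} {a : ℝ} (ha : 0 ≤ a) (t : ι → ℝ)
    (s : Finset ι) (c : ℝ) :
    (1 + c) * ((a + 1) ^ s.card - a ^ s.card) + (a + 1) ^ s.card / (a + 1) * ∑ i ∈ s, t i ≤
      exp c * (∏ i ∈ s, (a + exp (t i)) - a ^ s.card) := by
  induction s using Finset.cons_induction with
  | empty => simp
  | cons j s hj ih =>
    have h₁ := mul_le_mul_of_nonneg_left ih ha
    have h₂ := add_mul_sum_le_exp_mul_prod ha t s (c + t j)
    rw [exp_add] at h₂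
    rw [Finset.card_cons, Finset.sum_cons, Finset.prod_cons]
    have ha' : a + 1 ≠ 0 := by positivity
    calc _ = a * ((1 + c) * ((a + 1) ^ s.card - a ^ s.card) +
            (a + 1) ^ s.card / (a + 1) * ∑ i ∈ s, t i) +
          ((1 + (c + t j)) * (a + 1) ^ s.card +
            (a + 1) ^ s.card / (a + 1) * ∑ i ∈ s, t i) := by
          field_simp
          ring
      _ ≤ _ := add_le_add h₁ h₂
      _ = _ := by ring

open Real in
theorem pow_add_mul_sum_exp_le_prod {ι : Type*} {a : ℝ} (ha : 0 ≤ a) (t : ι → ℝ)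
    {s : Finset ι} (hs : s.Nonempty) :
    (a + 1) ^ s.card + a ^ (s.card - 1) * ∑ i ∈ s, (exp (t i) - 1 - t i) +
      (a + 1) ^ (s.card - 1) * ∑ i ∈ s, t i ≤ ∏ i ∈ s, (a + exp (t i)) := by
  induction hs using Finset.Nonempty.cons_induction with
  | singleton j => simp; linarith
  | cons j s hj hs ih =>
    obtain ⟨n, hn⟩ := Nat.exists_eq_succ_of_ne_zero hs.card_ne_zero
    have h₁ := mul_le_mul_of_nonneg_left ih ha
    have h₂ := add_mul_sum_le_exp_mul_prod_sub ha t s (t j)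
    have ha' : a + 1 ≠ 0 := by positivity
    rw [Finset.card_cons, Finset.sum_cons, Finset.sum_cons, Finset.prod_cons]
    rw [hn, Nat.succ_eq_add_one] at h₁ h₂ ⊢
    rw [pow_succ (a + 1) n, mul_div_cancel_right₀ _ ha'] at h₂
    simp only [Nat.add_sub_cancel] at h₁ ⊢
    linear_combination h₁ + h₂

/-- If positive reals have product at least `1`, then all terms of degree at least two in the
expansion of `∏ (a + y i)` are at least the corresponding terms of `(a + 1) ^ n`. -/
theorem pow_add_mul_sum_le_prod {ι : Type*} {a : ℝ} (ha : 0 ≤ a) {y : ι → ℝ}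
    {s : Finset ι} (hs : s.Nonempty) (hy : ∀ i ∈ s, 0 < y i) (hprod : 1 ≤ ∏ i ∈ s, y i) :
    (a + 1) ^ s.card + a ^ (s.card - 1) * ∑ i ∈ s, (y i - 1) ≤ ∏ i ∈ s, (a + y i) := by
  have key := pow_add_mul_sum_exp_le_prod ha (fun i ↦ Real.log (y i)) hs
  have hexp : ∀ i ∈ s, Real.exp (Real.log (y i)) = y i := fun i hi ↦ Real.exp_log (hy i hi)
  rw [Finset.prod_congr rfl fun i hi ↦ congrArg (a + ·) (hexp i hi),
    Finset.sum_congr rfl fun i hi ↦ congrArg (· - 1 - Real.log (y i)) (hexp i hi),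
    Finset.sum_sub_distrib] at key
  have hlog : 0 ≤ ∑ i ∈ s, Real.log (y i) := by
    rw [← Real.log_prod fun i hi ↦ (hy i hi).ne']
    exact Real.log_nonneg hprod
  have hpow : a ^ (s.card - 1) ≤ (a + 1) ^ (s.card - 1) :=
    pow_le_pow_left₀ ha (by linarith) _
  linarith [mul_le_mul_of_nonneg_right hpow hlog]

/-- **Lower bound depending on the trace.**
In the integral real-Weil-polynomial setting, one has
`∏ (q + 1 + x i) ≥ (q + 1 − m)^g + (q − m)^(g−1) · (g·m + τ)`
(with the convention `0^0 = 1`, which is Lean's default for natural powers). -/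
theorem stmt_6 (q : ℕ) (hq : 2 ≤ q) (m : ℤ) (hm : m = ⌊2 * Real.sqrt q⌋)
    (g : ℕ) (hg : 1 ≤ g) (x : Fin g → ℝ)
    (hx : ∀ i, |x i| ≤ 2 * Real.sqrt q)
    (hint : ∃ hz : Polynomial ℤ,
      hz.map (Int.castRingHom ℝ) = ∏ i, (Polynomial.X + Polynomial.C (x i)))
    (τ : ℤ) (hτ : (τ : ℝ) = ∑ i, x i) :
    ((q : ℝ) + 1 - m) ^ g + ((q : ℝ) - m) ^ (g - 1) * ((g : ℝ) * m + τ) ≤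
      ∏ i, ((q : ℝ) + 1 + x i) := by
  have hq0 : (0 : ℝ) ≤ q := Nat.cast_nonneg q
  have hq1 : (2 : ℝ) ≤ q := by exact_mod_cast hq
  have hlt : 2 * Real.sqrt q < m + 1 := hm ▸ Int.lt_floor_add_one _
  have hmq : (m : ℝ) ≤ q := by
    have h : m < (q : ℤ) + 1 := by
      rw [hm, Int.floor_lt]
      push_cast
      nlinarith [Real.sq_sqrt hq0, sq_nonneg (Real.sqrt q - 1)]
    exact_mod_cast Int.lt_add_one_iff.mp h
  have hy : ∀ i, 0 < x i + m + 1 := fun i ↦ by linarith [(abs_le.mp (hx i)).1]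
  have hprod : 1 ≤ ∏ i, (x i + m + 1) := by
    obtain ⟨p, hp⟩ := hint
    have heval : ((p.eval (m + 1) : ℤ) : ℝ) = ∏ i, (x i + m + 1) := by
      have h := congrArg (Polynomial.eval (Int.castRingHom ℝ (m + 1))) hp
      rw [Polynomial.eval_map_apply, Polynomial.eval_prod] at h
      rw [← eq_intCast (Int.castRingHom ℝ), h]
      refine Finset.prod_congr rfl fun i _ ↦ ?_
      simp
      ring
    have hpos : 0 < ∏ i, (x i + m + 1) := Finset.prod_pos fun i _ ↦ hy i
    rw [← heval] at hpos ⊢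
    exact_mod_cast hpos
  have : Nonempty (Fin g) := ⟨⟨0, hg⟩⟩
  have key := pow_add_mul_sum_le_prod (sub_nonneg.mpr hmq) Finset.univ_nonempty
    (fun i _ ↦ hy i) hprod
  convert key using 1
  · simp only [Finset.card_univ, Fintype.card_fin, add_sub_cancel_right, Finset.sum_add_distrib,
      Finset.sum_const, nsmul_eq_mul, hτ]
    ring
  · exact Finset.prod_congr rfl fun i _ ↦ by ring
end

section
/- With q, m, g, x_1, …, x_g as in the integral real-Weil-polynomial setting, assume g ≥ 2 and let η > 0 be the harmonic mean of the positive numbers q + 1 + x_i, i.e. g/η = Σ_{i=1}^g 1/(q + 1 + x_i). Then ∏_{i=1}^g (q + 1 + x_i) ≥ η·(q + 1 − m)^{g−1} + η·((g−1)/g)·(q − m)^{g−2}·(g·m + τ). -/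
/-- Subset expansion without the constant term, bounding each product by `1 + log`. -/
lemma mul_prod_add_sub_ge {ι : Type*} (c : ℝ) (hc : 0 ≤ c) (z : ι → ℝ) (T : Finset ι)
    (hz : ∀ j ∈ T, 0 < z j) (w : ℝ) (hw : 0 < w) :
    ((c + 1) ^ T.card - c ^ T.card) * (1 + Real.log w) +
        (c + 1) ^ (T.card - 1) * ∑ j ∈ T, Real.log (z j) ≤
      w * (∏ j ∈ T, (c + z j) - c ^ T.card) := by
  classical
  induction T using Finset.induction_on generalizing w with
  | empty => simp
  | insert a T ha ih =>
    have hza := hz a (Finset.mem_insert_self a T)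
    have hzT : ∀ j ∈ T, 0 < z j := fun j hj => hz j (Finset.mem_insert_of_mem hj)
    have h₁ := mul_le_mul_of_nonneg_left (ih hzT w hw) hc
    have h₂ := ih hzT (w * z a) (mul_pos hw hza)
    have h₃ : c ^ T.card * (1 + Real.log (w * z a)) ≤ c ^ T.card * (w * z a) :=
      mul_le_mul_of_nonneg_left (by linarith [Real.log_le_sub_one_of_pos (mul_pos hw hza)])
        (pow_nonneg hc _)
    rw [Real.log_mul hw.ne' hza.ne'] at h₂ h₃
    rw [Finset.prod_insert ha, Finset.sum_insert ha, Finset.card_insert_of_notMem ha,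
      Nat.add_sub_cancel]
    have h₄ : (c + 1) ^ T.card * ∑ j ∈ T, Real.log (z j) =
        (c + 1) * ((c + 1) ^ (T.card - 1) * ∑ j ∈ T, Real.log (z j)) := by
      rcases T.eq_empty_or_nonempty with rfl | hT
      · simp
      · rw [← mul_assoc, mul_pow_sub_one hT.card_pos.ne']
    rw [mul_add ((c + 1) ^ T.card), h₄]
    simp only [pow_succ]
    linarith

/-- Subset expansion keeping the linear term exact and bounding every other product by
`1 + log`. -/
lemma prod_add_ge {ι : Type*} (c : ℝ) (hc : 0 ≤ c) (z : ι → ℝ) (T : Finset ι)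
    (hz : ∀ j ∈ T, 0 < z j) :
    (c + 1) ^ T.card + c ^ (T.card - 1) * ∑ j ∈ T, (z j - 1) +
        ((c + 1) ^ (T.card - 1) - c ^ (T.card - 1)) * ∑ j ∈ T, Real.log (z j) ≤
      ∏ j ∈ T, (c + z j) := by
  classical
  induction T using Finset.induction_on with
  | empty => simp
  | insert a T ha ih =>
    have hza := hz a (Finset.mem_insert_self a T)
    have hzT : ∀ j ∈ T, 0 < z j := fun j hj => hz j (Finset.mem_insert_of_mem hj)
    have h₁ := mul_le_mul_of_nonneg_left (ih hzT) hc
    have h₂ := mul_prod_add_sub_ge c hc z T hzT (z a) hza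
    rw [Finset.prod_insert ha, Finset.sum_insert ha, Finset.sum_insert ha,
      Finset.card_insert_of_notMem ha, Nat.add_sub_cancel]
    rcases T.eq_empty_or_nonempty with rfl | hT
    · simp
    · obtain ⟨k, hk⟩ := Nat.exists_eq_succ_of_ne_zero hT.card_pos.ne'
      simp only [hk, Nat.succ_eq_add_one, Nat.add_sub_cancel, pow_succ] at h₁ h₂ ⊢
      linarith

/-- Lower bound for the sum of the leave-one-out products when the product is at least one. -/
lemma sum_prod_erase_add_ge {ι : Type*} [DecidableEq ι] (c : ℝ) (hc : 0 ≤ c) (z : ι → ℝ)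
    (T : Finset ι) (hz : ∀ j ∈ T, 0 < z j) (hprod : 1 ≤ ∏ j ∈ T, z j) :
    T.card * (c + 1) ^ (T.card - 1) +
        ((T.card : ℝ) - 1) * (c ^ (T.card - 2) * ∑ j ∈ T, (z j - 1)) ≤
      ∑ i ∈ T, ∏ j ∈ T.erase i, (c + z j) := by
  rcases T.eq_empty_or_nonempty with rfl | hT
  · simp
  have hlog : 0 ≤ ∑ j ∈ T, Real.log (z j) := by
    rw [← Real.log_prod fun j hj => (hz j hj).ne']
    exact Real.log_nonneg hprod
  have hcard : (1 : ℝ) ≤ T.card := by exact_mod_cast hT.card_pos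
  have hpow : c ^ (T.card - 2) ≤ (c + 1) ^ (T.card - 2) :=
    pow_le_pow_left₀ hc (by linarith) _
  have hK := mul_nonneg (mul_nonneg (sub_nonneg.2 hcard) (sub_nonneg.2 hpow)) hlog
  have hle := Finset.sum_le_sum fun i hi => by
    have h := prod_add_ge c hc z (T.erase i) fun j hj => hz j (Finset.mem_of_mem_erase hj)
    rwa [Finset.sum_erase_eq_sub hi, Finset.sum_erase_eq_sub hi, Finset.card_erase_of_mem hi,
      Nat.sub_sub] at h
  refine le_trans ?_ hle
  simp only [Finset.sum_add_distrib, ← Finset.mul_sum, Finset.sum_sub_distrib, Finset.sum_const,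
    nsmul_eq_mul] at hK ⊢
  linarith

/-- **Lower bound in terms of the harmonic mean `η`.**
In the integral real-Weil-polynomial setting with `g ≥ 2`, if `η > 0` is the harmonic mean
of the positive numbers `q + 1 + x i` (i.e. `g/η = Σ 1/(q + 1 + x i)`), then
`∏ (q + 1 + x i) ≥ η(q + 1 − m)^(g−1) + η((g−1)/g)(q − m)^(g−2)(g·m + τ)`. -/
theorem stmt_8 (q : ℕ) (hq : 2 ≤ q) (m : ℤ) (hm : m = ⌊2 * Real.sqrt q⌋)
    (g : ℕ) (hg : 2 ≤ g) (x : Fin g → ℝ)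
    (hx : ∀ i, |x i| ≤ 2 * Real.sqrt q)
    (hint : ∃ hz : Polynomial ℤ,
      hz.map (Int.castRingHom ℝ) = ∏ i, (Polynomial.X + Polynomial.C (x i)))
    (τ : ℤ) (hτ : (τ : ℝ) = ∑ i, x i)
    (η : ℝ) (hηpos : 0 < η) (hη : (g : ℝ) / η = ∑ i, 1 / ((q : ℝ) + 1 + x i)) :
    η * ((q : ℝ) + 1 - m) ^ (g - 1) +
        η * (((g : ℝ) - 1) / g) * ((q : ℝ) - m) ^ (g - 2) * ((g : ℝ) * m + τ) ≤
      ∏ i, ((q : ℝ) + 1 + x i) := by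
  have hq₀ : (0 : ℝ) < q := by positivity
  have hsq : Real.sqrt q ^ 2 = q := Real.sq_sqrt hq₀.le
  have hsq₁ : 1 < Real.sqrt q := Real.lt_sqrt_of_sq_lt (by norm_num; exact_mod_cast hq)
  have hmle : (m : ℝ) ≤ 2 * Real.sqrt q := hm ▸ Int.floor_le _
  have hltm : 2 * Real.sqrt q < m + 1 := hm ▸ Int.lt_floor_add_one _
  have hmq : (m : ℝ) ≤ q := by
    have h : (m : ℝ) < (q : ℝ) + 1 := by nlinarith
    have h' : m < (q : ℤ) + 1 := by exact_mod_cast h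
    exact_mod_cast Int.lt_add_one_iff.1 h'
  have hz : ∀ i ∈ Finset.univ, 0 < (m : ℝ) + 1 + x i := fun i _ => by
    linarith [(abs_le.1 (hx i)).1]
  have hprod : 1 ≤ ∏ i, ((m : ℝ) + 1 + x i) := by
    obtain ⟨p, hp⟩ := hint
    have h : ((p.eval (m + 1) : ℤ) : ℝ) = ∏ i, ((m : ℝ) + 1 + x i) := by
      have := congrArg (Polynomial.eval (((m + 1 : ℤ) : ℝ))) hp
      rw [Polynomial.eval_intCast_map] at this
      simpa [Polynomial.eval_prod] using this
    have hpos := Finset.prod_pos hz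
    rw [← h] at hpos ⊢
    exact_mod_cast hpos
  have hy : ∀ i, 0 < (q : ℝ) + 1 + x i := fun i => by
    linarith [hz i (Finset.mem_univ i)]
  have hsum := sum_prod_erase_add_ge ((q : ℝ) - m) (by linarith) (fun i => (m : ℝ) + 1 + x i)
    Finset.univ hz hprod
  have herase : ∑ i, ∏ j ∈ Finset.univ.erase i, ((q : ℝ) - m + ((m : ℝ) + 1 + x j)) =
      g / η * ∏ i, ((q : ℝ) + 1 + x i) := by
    rw [hη, Finset.sum_mul]
    refine Finset.sum_congr rfl fun i hi => ?_
    rw [← Finset.mul_prod_erase _ _ hi, ← mul_assoc, one_div_mul_cancel (hy i).ne', one_mul]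
    exact Finset.prod_congr rfl fun j _ => by ring
  have hlin : ∑ i, ((m : ℝ) + 1 + x i - 1) = g * m + τ := by
    rw [hτ]
    simp [Finset.sum_add_distrib, Finset.sum_sub_distrib]
    ring
  rw [herase, hlin, Finset.card_univ, Fintype.card_fin] at hsum
  have hg₀ : (0 : ℝ) < g := by positivity
  have h := mul_le_mul_of_nonneg_left hsum (div_pos hηpos hg₀).le
  rw [← mul_assoc _ (g / η : ℝ), div_mul_div_cancel₀ hg₀.ne', div_self hηpos.ne', one_mul] at h
  refine le_of_eq_of_le ?_ h
  rw [sub_add_eq_add_sub]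
  field_simp
end

section
/- With q, m, g, x_1, …, x_g as in the integral real-Weil-polynomial setting, assume moreover that q is a prime power with q ≥ 8, and let η > 0 be the harmonic mean of the positive numbers q + 1 + x_i, i.e. g/η = Σ_{i=1}^g 1/(q + 1 + x_i). Then η ≥ q + 1 − m. -/
/-- A strengthening of `log u ≤ u - 1` for `u ≥ 1`. -/
lemma log_le_sub_one_div_sqrt {u : ℝ} (hu : 1 ≤ u) :
    Real.log u ≤ (u - 1) / Real.sqrt u := by
  have hs : 0 < Real.sqrt u := Real.sqrt_pos.2 (by linarith)
  have hsq : Real.sqrt u ^ 2 = u := Real.sq_sqrt (by linarith)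
  have h : Real.log (Real.sqrt u) ≤ Real.sinh (Real.log (Real.sqrt u)) :=
    Real.self_le_sinh_iff.2 (Real.log_nonneg (Real.one_le_sqrt.2 hu))
  rw [Real.sinh_log hs, Real.log_sqrt (by linarith)] at h
  have e : (u - 1) / Real.sqrt u = Real.sqrt u - (Real.sqrt u)⁻¹ := by
    field_simp
    rw [hsq]
  rw [e]
  linarith

lemma log_le_of_one_le_of_le_sq {a u : ℝ} (ha : 1 ≤ a) (hu : 1 ≤ u) (hua : u ≤ a ^ 2) :
    Real.log u ≤ (u - 1) * (a + 1) / (a + u) := by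
  refine (log_le_sub_one_div_sqrt hu).trans ?_
  have hs : 1 ≤ Real.sqrt u := Real.one_le_sqrt.2 hu
  have hsq : Real.sqrt u ^ 2 = u := Real.sq_sqrt (by linarith)
  have hsa : Real.sqrt u ≤ a := Real.sqrt_le_left (by linarith) |>.2 hua
  rw [div_le_div_iff₀ (by linarith) (by linarith), mul_assoc]
  refine mul_le_mul_of_nonneg_left ?_ (by linarith)
  nlinarith [mul_nonneg (sub_nonneg.2 hs) (sub_nonneg.2 hsa)]

lemma log_le_of_le_one {a u : ℝ} (ha : 1 ≤ a) (hu0 : 0 < u) (hu : u ≤ 1) :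
    Real.log u ≤ (u - 1) * (a + 1) / (a + u) := by
  have hw : 1 ≤ u⁻¹ := (one_le_inv₀ hu0).2 hu
  have h := Real.le_log_one_add_of_nonneg (sub_nonneg.2 hw)
  rw [add_sub_cancel, Real.log_inv] at h
  have e : 2 * (u⁻¹ - 1) / (u⁻¹ - 1 + 2) = 2 * (1 - u) / (1 + u) := by
    have : u⁻¹ - 1 + 2 = (1 + u) / u := by field_simp; ring
    rw [this]
    field_simp
  rw [e] at h
  have h2 : (1 - u) * (a + 1) / (a + u) ≤ 2 * (1 - u) / (1 + u) := by
    rw [div_le_div_iff₀ (by linarith) (by linarith)]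
    nlinarith [mul_nonneg (mul_nonneg (sub_nonneg.2 hu) (sub_nonneg.2 hu)) (sub_nonneg.2 ha)]
  have e2 : (u - 1) * (a + 1) / (a + u) = -((1 - u) * (a + 1) / (a + u)) := by ring
  rw [e2]
  linarith

lemma log_le_eight_thirds {u : ℝ} (hu0 : 0 < u) (hu : u ≤ 13) : Real.log u ≤ 8 / 3 := by
  rw [Real.log_le_iff_le_exp hu0]
  have h1 := Real.exp_one_gt_d9
  have h2 : Real.exp (8 / 3) ^ 3 = Real.exp 1 ^ 8 := by
    rw [← Real.exp_nat_mul, ← Real.exp_nat_mul]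
    norm_num
  have h3 : (13 : ℝ) ^ 3 ≤ Real.exp (8 / 3) ^ 3 := by
    rw [h2]
    calc (13 : ℝ) ^ 3 ≤ 2.7 ^ 8 := by norm_num
      _ ≤ Real.exp 1 ^ 8 := by gcongr; linarith
  exact hu.trans (le_of_pow_le_pow_left₀ (by norm_num) (Real.exp_pos _).le h3)

lemma log_le_of_le_sq_or_le {a u : ℝ} (ha : 1 ≤ a) (hu0 : 0 < u)
    (hua : u ≤ a ^ 2 ∨ a = 3 ∧ u ≤ 13) :
    Real.log u ≤ (u - 1) * (a + 1) / (a + u) := by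
  rcases le_total u 1 with hu | hu
  · exact log_le_of_le_one ha hu0 hu
  rcases le_or_gt u (a ^ 2) with h | h
  · exact log_le_of_one_le_of_le_sq ha hu h
  obtain ⟨rfl, h13⟩ := hua.resolve_left h.not_ge
  refine (log_le_eight_thirds hu0 h13).trans ?_
  rw [le_div_iff₀ (by linarith)]
  linarith

/-- If positive reals `u i` have product at least one and satisfy the tangent-line bound for the
logarithm, then the mean of `1 / (a + u i)` is at most `1 / (a + 1)`. -/
lemma sum_one_div_add_le {ι : Type*} [Fintype ι] {a : ℝ} (ha : 0 < a) {u : ι → ℝ}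
    (hu0 : ∀ i, 0 < u i) (hprod : 1 ≤ ∏ i, u i)
    (hlog : ∀ i, Real.log (u i) ≤ (u i - 1) * (a + 1) / (a + u i)) :
    ∑ i, 1 / (a + u i) ≤ Fintype.card ι / (a + 1) := by
  have hpt : ∀ i, 1 / (a + u i) ≤ 1 / (a + 1) - Real.log (u i) / (a + 1) ^ 2 := by
    intro i
    have hi := hu0 i
    have e : 1 / (a + u i) =
        1 / (a + 1) - (u i - 1) * (a + 1) / (a + u i) / (a + 1) ^ 2 := by
      field_simp
      ring
    rw [e]
    gcongr
    exact hlog i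
  have hsum : 0 ≤ ∑ i, Real.log (u i) := by
    rw [← Real.log_prod fun i _ => (hu0 i).ne']
    exact Real.log_nonneg hprod
  calc ∑ i, 1 / (a + u i) ≤ ∑ i, (1 / (a + 1) - Real.log (u i) / (a + 1) ^ 2) :=
        Finset.sum_le_sum fun i _ => hpt i
    _ = Fintype.card ι / (a + 1) - (∑ i, Real.log (u i)) / (a + 1) ^ 2 := by
        simp [div_eq_mul_inv, Finset.sum_mul]
    _ ≤ Fintype.card ι / (a + 1) := sub_le_self _ (by positivity)

/-- A monic integer polynomial `∏ i, (X + x i)` whose factors are positive at an integer is at least one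
there. -/
lemma one_le_prod_intCast_add {ι : Type*} [Fintype ι] {x : ι → ℝ} {n : ℤ}
    (hint : ∃ hz : Polynomial ℤ,
      hz.map (Int.castRingHom ℝ) = ∏ i, (Polynomial.X + Polynomial.C (x i)))
    (hpos : ∀ i, 0 < (n : ℝ) + x i) : 1 ≤ ∏ i, ((n : ℝ) + x i) := by
  obtain ⟨hz, hz_eq⟩ := hint
  have h : ((hz.eval n : ℤ) : ℝ) = ∏ i, ((n : ℝ) + x i) := by
    have := congrArg (Polynomial.eval (n : ℝ)) hz_eq
    rw [Polynomial.eval_intCast_map, Polynomial.eval_prod] at this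
    simpa using this
  have h0 : 0 < ∏ i, ((n : ℝ) + x i) := Finset.prod_pos fun i _ => hpos i
  rw [← h] at h0 ⊢
  exact_mod_cast h0

lemma one_le_and_le_sq_or {q : ℕ} (hq : 8 ≤ q) {m : ℤ} (hm : m = ⌊2 * Real.sqrt q⌋) :
    1 ≤ (q : ℝ) - m ∧ (m + 1 + 2 * Real.sqrt q ≤ ((q : ℝ) - m) ^ 2 ∨
      (q : ℝ) - m = 3 ∧ m + 1 + 2 * Real.sqrt q ≤ 13) := by
  have hs0 := Real.sqrt_nonneg (q : ℝ)
  have hsq : Real.sqrt q ^ 2 = q := Real.sq_sqrt (Nat.cast_nonneg q)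
  have hmle : (m : ℝ) ≤ 2 * Real.sqrt q := hm ▸ Int.floor_le _
  rcases le_or_gt 11 q with h11 | h11
  · have hqR : (11 : ℝ) ≤ q := by exact_mod_cast h11
    generalize Real.sqrt (q : ℝ) = s at *
    have hs : 3.3 ≤ s := by nlinarith
    have h1 : 1.3 * s ≤ s * (s - 2) := by nlinarith
    have ha : s * (s - 2) ≤ q - m := by nlinarith
    have h2 : (s * (s - 2)) ^ 2 ≤ ((q : ℝ) - m) ^ 2 := by gcongr; nlinarith
    have h3 : (1.3 * s) ^ 2 ≤ (s * (s - 2)) ^ 2 := by gcongr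
    refine ⟨by linarith, Or.inl ?_⟩
    nlinarith
  · have key : ∀ k : ℤ, (k : ℝ) ^ 2 ≤ 4 * q → (4 * q : ℝ) < (k + 1) ^ 2 → 0 ≤ (k : ℝ) → m = k := by
      intro k h1 h2 h3
      rw [hm, Int.floor_eq_iff]
      constructor <;> nlinarith
    interval_cases q
    · obtain rfl := key 5 (by norm_num) (by norm_num) (by norm_num)
      push_cast at *
      refine ⟨by norm_num, Or.inr ⟨by norm_num, by nlinarith⟩⟩
    · obtain rfl := key 6 (by norm_num) (by norm_num) (by norm_num)
      push_cast at *
      refine ⟨by norm_num, Or.inr ⟨by norm_num, by nlinarith⟩⟩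
    · obtain rfl := key 6 (by norm_num) (by norm_num) (by norm_num)
      push_cast at *
      refine ⟨by norm_num, Or.inl (by nlinarith)⟩

/-- **Lower bound for the harmonic mean.**
In the integral real-Weil-polynomial setting, if moreover `q` is a prime power with
`q ≥ 8`, and `η > 0` is the harmonic mean of the positive numbers `q + 1 + x i`
(i.e. `g/η = Σ 1/(q + 1 + x i)`), then `η ≥ q + 1 − m`. -/
theorem stmt_9 (q : ℕ) (hq : 2 ≤ q) (hq8 : 8 ≤ q)
    (hqpp : ∃ p k : ℕ, p.Prime ∧ 0 < k ∧ q = p ^ k)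
    (m : ℤ) (hm : m = ⌊2 * Real.sqrt q⌋)
    (g : ℕ) (hg : 1 ≤ g) (x : Fin g → ℝ)
    (hx : ∀ i, |x i| ≤ 2 * Real.sqrt q)
    (hint : ∃ hz : Polynomial ℤ,
      hz.map (Int.castRingHom ℝ) = ∏ i, (Polynomial.X + Polynomial.C (x i)))
    (η : ℝ) (hηpos : 0 < η) (hη : (g : ℝ) / η = ∑ i, 1 / ((q : ℝ) + 1 + x i)) :
    (q : ℝ) + 1 - m ≤ η := by
  have hfl : 2 * Real.sqrt q < m + 1 := hm ▸ Int.lt_floor_add_one _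
  obtain ⟨ha, hbound⟩ := one_le_and_le_sq_or hq8 hm
  have hupos : ∀ i, 0 < ((m + 1 : ℤ) : ℝ) + x i := by
    intro i
    push_cast
    linarith [neg_le_of_abs_le (hx i)]
  have hlog : ∀ i, Real.log (((m + 1 : ℤ) : ℝ) + x i) ≤
      (((m + 1 : ℤ) : ℝ) + x i - 1) * ((q : ℝ) - m + 1) /
        ((q : ℝ) - m + (((m + 1 : ℤ) : ℝ) + x i)) := by
    intro i
    have hle : ((m + 1 : ℤ) : ℝ) + x i ≤ m + 1 + 2 * Real.sqrt q := by
      push_cast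
      linarith [le_of_abs_le (hx i)]
    exact log_le_of_le_sq_or_le ha (hupos i)
      (hbound.imp hle.trans (And.imp_right hle.trans))
  have hsum := sum_one_div_add_le (by linarith) hupos
    (one_le_prod_intCast_add hint hupos) hlog
  have hshift : ∀ i, (q : ℝ) - m + (((m + 1 : ℤ) : ℝ) + x i) = q + 1 + x i := by
    intro i
    push_cast
    ring
  simp only [hshift, Fintype.card_fin] at hsum
  rw [← hη, div_le_div_iff_of_pos_left (by exact_mod_cast hg) hηpos (by linarith)] at hsum
  linarith
end

section
/- Let q ≥ 2 be a real number, g ≥ 1 an integer, and x_1, …, x_g real numbers with |x_i| ≤ 2√q; set τ = x_1 + ⋯ + x_g and ω = τ/(2√q). Let δ = 0 if g + ω is an even integer and δ = 1 otherwise. Then ∏_{i=1}^g (q + 1 + x_i) ≥ (q − 1)^g · ((√q + 1)/(√q − 1))^{ω − 2δ}, where the last power is a real power of a positive base. -/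
/-- The chord bound for the exponential `y ↦ R ^ y` on `[-1, 1]`. -/
theorem rpow_le_chord {R y : ℝ} (hR : 0 < R) (hy : |y| ≤ 1) :
    R ^ y ≤ (1 + y) / 2 * R + (1 - y) / 2 * R⁻¹ := by
  obtain ⟨hy₁, hy₂⟩ := abs_le.mp hy
  have h := Real.geom_mean_le_arith_mean2_weighted (by linarith : 0 ≤ (1 + y) / 2)
    (by linarith : 0 ≤ (1 - y) / 2) hR.le (inv_pos.mpr hR).le (by ring)
  rwa [Real.inv_rpow hR.le, ← Real.rpow_neg hR.le, ← Real.rpow_add hR,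
    show (1 + y) / 2 + -((1 - y) / 2) = y by ring] at h

/-- A single factor `s² + 1 + x` with `|x| ≤ 2s` is bounded below by an exponential in `x`. -/
theorem sq_sub_one_mul_rpow_le {s x : ℝ} (hs : 1 < s) (hx : |x| ≤ 2 * s) :
    (s ^ 2 - 1) * ((s + 1) / (s - 1)) ^ (x / (2 * s)) ≤ s ^ 2 + 1 + x := by
  have hs₁ : 0 < s - 1 := by linarith
  have hs₀ : 0 < 2 * s := by linarith
  have hy : |x / (2 * s)| ≤ 1 := by
    rw [abs_div, abs_of_pos hs₀]
    exact div_le_one_of_le₀ hx hs₀.le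
  have h := rpow_le_chord (R := (s + 1) / (s - 1)) (by positivity) hy
  calc (s ^ 2 - 1) * ((s + 1) / (s - 1)) ^ (x / (2 * s))
      ≤ (s ^ 2 - 1) * ((1 + x / (2 * s)) / 2 * ((s + 1) / (s - 1))
          + (1 - x / (2 * s)) / 2 * ((s + 1) / (s - 1))⁻¹) :=
        mul_le_mul_of_nonneg_left h (by nlinarith)
    _ = s ^ 2 + 1 + x := by
        have : s + 1 ≠ 0 := by linarith
        have : s ≠ 0 := by linarith
        field_simp
        ring


/-- **Perret's convexity lower bound.**
Let `q ≥ 2` be real, `g ≥ 1`, `|x i| ≤ 2√q`, `τ = Σ x i` and `ω = τ/(2√q)`.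
Let `δ = 0` if `g + ω` is an even integer and `δ = 1` otherwise. Then
`∏ (q + 1 + x i) ≥ (q − 1)^g · ((√q + 1)/(√q − 1))^(ω − 2δ)`,
the last power being a real power of a positive base. -/
theorem stmt_10 (q : ℝ) (hq : 2 ≤ q) (g : ℕ) (hg : 1 ≤ g) (x : Fin g → ℝ)
    (hx : ∀ i, |x i| ≤ 2 * Real.sqrt q) (τ : ℝ) (hτ : τ = ∑ i, x i)
    (ω : ℝ) (hω : ω = τ / (2 * Real.sqrt q))
    (δ : ℝ)
    (hδ0 : (∃ k : ℤ, Even k ∧ (g : ℝ) + ω = (k : ℝ)) → δ = 0)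
    (hδ1 : (¬∃ k : ℤ, Even k ∧ (g : ℝ) + ω = (k : ℝ)) → δ = 1) :
    (q - 1) ^ g * ((Real.sqrt q + 1) / (Real.sqrt q - 1)) ^ (ω - 2 * δ) ≤
      ∏ i, (q + 1 + x i) := by
  have hs : 1 < √q := Real.lt_sqrt_of_sq_lt (by linarith)
  have hsq : √q ^ 2 = q := Real.sq_sqrt (by linarith)
  have hs₁ : 0 < √q - 1 := by linarith
  have hR : 1 ≤ (√q + 1) / (√q - 1) := by
    rw [one_le_div hs₁]
    linarith
  have hδ : 0 ≤ δ := by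
    by_cases h : ∃ k : ℤ, Even k ∧ (g : ℝ) + ω = (k : ℝ)
    · exact (hδ0 h).ge
    · exact (hδ1 h) ▸ zero_le_one
  have hq₁ : 0 ≤ q - 1 := by linarith
  calc (q - 1) ^ g * ((√q + 1) / (√q - 1)) ^ (ω - 2 * δ)
      ≤ (q - 1) ^ g * ((√q + 1) / (√q - 1)) ^ ω := by
        gcongr
        linarith
    _ = ∏ i, (q - 1) * ((√q + 1) / (√q - 1)) ^ (x i / (2 * √q)) := by
        rw [Finset.prod_mul_distrib, Finset.prod_const, Finset.card_univ, Fintype.card_fin,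
          ← Real.rpow_sum_of_pos (by linarith), ← Finset.sum_div, hω, hτ]
    _ ≤ ∏ i, (q + 1 + x i) := by
        refine Finset.prod_le_prod (fun i _ => by positivity) fun i _ => ?_
        simpa only [hsq] using sq_sub_one_mul_rpow_le hs (hx i)
end

section
/- Let q ≥ 2 be a real number, g ≥ 1 an integer, and x_1, …, x_g real numbers with |x_i| ≤ 2√q; set τ = x_1 + ⋯ + x_g and ω = τ/(2√q). Define the integers r = ⌊(g + ⌊ω⌋)/2⌋ and s = ⌊(g − 1 − ⌊ω⌋)/2⌋ (s may equal −1). Then ∏_{i=1}^g (q + 1 + x_i) ≥ (q + 1 + τ − 2(r − s)√q) · (q + 1 + 2√q)^r · (q + 1 − 2√q)^s, where the powers are integer (possibly negative) powers of positive reals. -/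
/-- A product of numbers in `[a, b]` is at least the product of an extremal configuration with the
same sum, in which all factors but one are endpoints of `[a, b]`. -/
theorem exists_extremal_le_prod {ι : Type*} (t : Finset ι) (y : ι → ℝ) {a b : ℝ}
    (ha : 0 < a) (hab : a ≤ b) (hy : ∀ i, y i ∈ Set.Icc a b) :
    ∃ r s : ℤ, ∃ m ∈ Set.Icc a b, r + s + 1 = (t.card : ℤ) ∧
      ∑ i ∈ t, y i = r * b + s * a + m ∧ b ^ r * a ^ s * m ≤ ∏ i ∈ t, y i := by
  classical
  have hb : 0 < b := ha.trans_le hab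
  induction t using Finset.induction_on with
  | empty => exact ⟨0, -1, a, ⟨le_rfl, hab⟩, by simp, by simp, by simp [ha.ne']⟩
  | insert i t hi ih =>
    obtain ⟨r, s, m, ⟨hma, hmb⟩, hcard, hsum, hprod⟩ := ih
    obtain ⟨hya, hyb⟩ := hy i
    rw [Finset.sum_insert hi, Finset.prod_insert hi, Finset.card_insert_of_notMem hi, hsum]
    have hstep : y i * (b ^ r * a ^ s * m) ≤ y i * ∏ j ∈ t, y j :=
      mul_le_mul_of_nonneg_left hprod (ha.le.trans hya)
    have hpos : 0 < b ^ r * a ^ s := mul_pos (zpow_pos hb r) (zpow_pos ha s)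
    rcases le_total (y i + m) (a + b) with h | h
    · refine ⟨r, s + 1, y i + m - a, ⟨by linarith, by linarith⟩, by push_cast; linarith,
        by push_cast; ring, le_trans ?_ hstep⟩
      have hswap : a * (y i + m - a) ≤ y i * m := by
        nlinarith [mul_nonneg (sub_nonneg.2 hya) (sub_nonneg.2 hma)]
      calc b ^ r * a ^ (s + 1) * (y i + m - a)
          = b ^ r * a ^ s * (a * (y i + m - a)) := by rw [zpow_add_one₀ ha.ne']; ring
        _ ≤ b ^ r * a ^ s * (y i * m) := mul_le_mul_of_nonneg_left hswap hpos.le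
        _ = y i * (b ^ r * a ^ s * m) := by ring
    · refine ⟨r + 1, s, y i + m - b, ⟨by linarith, by linarith⟩, by push_cast; linarith,
        by push_cast; ring, le_trans ?_ hstep⟩
      have hswap : b * (y i + m - b) ≤ y i * m := by
        nlinarith [mul_nonneg (sub_nonneg.2 hyb) (sub_nonneg.2 hmb)]
      calc b ^ (r + 1) * a ^ s * (y i + m - b)
          = b ^ r * a ^ s * (b * (y i + m - b)) := by rw [zpow_add_one₀ hb.ne']; ring
        _ ≤ b ^ r * a ^ s * (y i * m) := mul_le_mul_of_nonneg_left hswap hpos.le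
        _ = y i * (b ^ r * a ^ s * m) := by ring

/-- Extremal configurations with the same number of factors and the same sum have the same
product. -/
theorem extremal_prod_eq {a b m m' : ℝ} {r s r' s' : ℤ} (ha : 0 < a) (hab : a < b)
    (hm : m ∈ Set.Icc a b) (hm' : m' ∈ Set.Icc a b) (hcard : r + s = r' + s')
    (hsum : r * b + s * a + m = r' * b + s' * a + m') :
    b ^ r * a ^ s * m = b ^ r' * a ^ s' * m' := by
  wlog hrr : r' ≤ r generalizing r s r' s' m m'
  · exact (this hm' hm hcard.symm hsum.symm (le_of_not_ge hrr)).symm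
  have hb : 0 < b := ha.trans hab
  obtain ⟨k, rfl⟩ : ∃ k, r = r' + k := ⟨r - r', by ring⟩
  obtain rfl : s' = s + k := by linarith
  obtain ⟨hma, hmb⟩ := hm
  obtain ⟨hma', hmb'⟩ := hm'
  push_cast at hsum
  have hk : (k : ℝ) * (b - a) = m' - m := by linarith
  have hk1 : (k : ℝ) ≤ 1 := le_of_mul_le_mul_right (by linarith) (sub_pos.2 hab)
  have hk1' : k ≤ 1 := by exact_mod_cast hk1
  obtain rfl | rfl : k = 0 ∨ k = 1 := by lia
  · obtain rfl : m' = m := by push_cast at hk; linarith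
    simp
  · push_cast at hk
    obtain rfl : m' = b := by linarith
    obtain rfl : m = a := by linarith
    rw [zpow_add_one₀ hb.ne', zpow_add_one₀ ha.ne']
    ring


/-- **Refined Perret-type lower bound.**
Let `q ≥ 2` be real, `g ≥ 1`, `|x i| ≤ 2√q`, `τ = Σ x i`, `ω = τ/(2√q)`, and set
`r = ⌊(g + ⌊ω⌋)/2⌋` and `s = ⌊(g − 1 − ⌊ω⌋)/2⌋` (integers; `s` may equal `−1`). Then
`∏ (q + 1 + x i) ≥ (q + 1 + τ − 2(r − s)√q)(q + 1 + 2√q)^r (q + 1 − 2√q)^s`,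
the powers being integer (possibly negative) powers of positive reals. -/
theorem stmt_11 (q : ℝ) (hq : 2 ≤ q) (g : ℕ) (hg : 1 ≤ g) (x : Fin g → ℝ)
    (hx : ∀ i, |x i| ≤ 2 * Real.sqrt q) (τ : ℝ) (hτ : τ = ∑ i, x i)
    (ω : ℝ) (hω : ω = τ / (2 * Real.sqrt q))
    (r s : ℤ) (hr : r = ((g : ℤ) + ⌊ω⌋) / 2) (hs : s = ((g : ℤ) - 1 - ⌊ω⌋) / 2) :
    (q + 1 + τ - 2 * ((r : ℝ) - (s : ℝ)) * Real.sqrt q) *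
        (q + 1 + 2 * Real.sqrt q) ^ r * (q + 1 - 2 * Real.sqrt q) ^ s ≤
      ∏ i, (q + 1 + x i) := by
  have hq0 : 0 < q := by linarith
  have hsq : Real.sqrt q ^ 2 = q := Real.sq_sqrt hq0.le
  have hu : 0 < Real.sqrt q := Real.sqrt_pos.2 hq0
  have hu1 : 1 < Real.sqrt q := Real.lt_sqrt_of_sq_lt (by linarith)
  have ha : 0 < q + 1 - 2 * Real.sqrt q := by nlinarith
  have hab : q + 1 - 2 * Real.sqrt q < q + 1 + 2 * Real.sqrt q := by linarith
  have hω' : τ = 2 * Real.sqrt q * ω := by rw [hω]; field_simp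
  have hfl := mul_le_mul_of_nonneg_left (Int.floor_le ω) hu.le
  have hfu := mul_le_mul_of_nonneg_left (Int.lt_floor_add_one ω).le hu.le
  have hcard : r + s + 1 = (g : ℤ) := by lia
  have hcardR : (r : ℝ) + s + 1 = g := by exact_mod_cast hcard
  have hm : q + 1 + τ - 2 * ((r : ℝ) - (s : ℝ)) * Real.sqrt q ∈
      Set.Icc (q + 1 - 2 * Real.sqrt q) (q + 1 + 2 * Real.sqrt q) := by
    obtain h | h : r - s = ⌊ω⌋ + 1 ∨ r - s = ⌊ω⌋ := by lia
    all_goals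
      have hR : (r : ℝ) - s = ((r - s : ℤ) : ℝ) := by push_cast; ring
      rw [hR, h]
      push_cast
      constructor <;> nlinarith
  obtain ⟨r', s', m', hm', hcard', hsum', hprod'⟩ :=
    exists_extremal_le_prod Finset.univ (fun i => q + 1 + x i) ha hab.le
      (fun i => ⟨by linarith [(abs_le.1 (hx i)).1], by linarith [(abs_le.1 (hx i)).2]⟩)
  rw [Finset.card_univ, Fintype.card_fin] at hcard'
  have hsum : ∑ i, (q + 1 + x i) = g * (q + 1) + τ := by
    simp only [Finset.sum_add_distrib, hτ, Finset.sum_const, Finset.card_univ, Fintype.card_fin,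
      nsmul_eq_mul]
    ring
  rw [hsum, ← hcardR] at hsum'
  have heq := extremal_prod_eq ha hab hm hm' (by linarith : r + s = r' + s')
    (by rw [← hsum']; ring)
  rw [← heq] at hprod'
  exact le_of_eq_of_le (by ring) hprod'
end
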